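/- For every n ≥ 1, the two conditional photon states produced by the protocol are orthogonal and of equal norm: with respect to the standard Hermitian inner product on H_n, ⟨S_+^(n), S_-^(n)⟩ = 0 and ‖S_+^(n)‖² = ‖S_-^(n)‖² = 2^n. (Consequently the two spin-measurement outcomes |↑⟩ and |↓⟩ occur with equal probability and each yields a well-defined normalized n-photon cluster state.) -/

import Mathlib

/-- The `n`-qubit state space `H_n = (Fin n → Bool) → ℂ`. -/
abbrev H (n : ℕ) := (Fin n → Bool) → ℂ

/-- Computational basis vector `|f⟩`. -/
noncomputable def ket {n : ℕ} (f : Fin n → Bool) : H n := fun g => if g = f then 1 else 0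

/-- Single-qubit basis vector: `qubit true = |1⟩`, `qubit false = |0⟩`. -/
noncomputable def qubit (b : Bool) : H 1 := ket (fun _ => b)

/-- Tensor product appending a single qubit as the last factor. -/
noncomputable def tensAppend {n : ℕ} (v : H n) (w : H 1) : H (n + 1) :=
  fun f => v (fun i => f i.castSucc) * w (fun _ => f (Fin.last n))

/-- The protocol states: `S k true = S_+^(k+1)`, `S k false = S_-^(k+1)`. -/
noncomputable def S : (k : ℕ) → Bool → H (k + 1)
  | 0, true => qubit true + qubit false
  | 0, false => qubit true - qubit false
  | k + 1, true =>
      tensAppend (S k true) (qubit true) + tensAppend (S k false) (qubit false)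
  | k + 1, false =>
      tensAppend (S k true) (qubit true) - tensAppend (S k false) (qubit false)

/-- The standard Hermitian inner product on `H_n`, in which the computational basis
vectors `|f⟩` are orthonormal. -/
noncomputable def hInner {n : ℕ} (v w : H n) : ℂ :=
  ∑ f : Fin n → Bool, (starRingEnd ℂ) (v f) * w f

theorem sum_split {n : ℕ} (F : (Fin (n + 1) → Bool) → ℂ) :
    ∑ f, F f = ∑ g : Fin n → Bool,
      (F (Fin.snoc (α := fun _ => Bool) g true) + F (Fin.snoc (α := fun _ => Bool) g false)) := by
  rw [← (Fin.snocEquiv (fun _ : Fin (n + 1) => Bool)).sum_comp, Fintype.sum_prod_type,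
    Fintype.sum_bool, ← Finset.sum_add_distrib]
  rfl

theorem qubit_const (b c : Bool) : qubit b (fun _ => c) = if c = b then 1 else 0 := by
  cases b <;> cases c <;> simp [qubit, ket, funext_iff]

theorem tensAppend_snoc {n : ℕ} (v : H n) (b c : Bool) (g : Fin n → Bool) :
    tensAppend v (qubit b) (Fin.snoc (α := fun _ => Bool) g c) = if c = b then v g else 0 := by
  simp [tensAppend, qubit_const]

theorem hInner_comb {n : ℕ} (v w v' w' : H n) :
    hInner (tensAppend v (qubit true) + tensAppend w (qubit false))
      (tensAppend v' (qubit true) + tensAppend w' (qubit false)) =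
      hInner v v' + hInner w w' := by
  simp [hInner, sum_split, tensAppend_snoc, Finset.sum_add_distrib]

theorem hInner_comb_sub {n : ℕ} (v w v' w' : H n) :
    hInner (tensAppend v (qubit true) + tensAppend w (qubit false))
      (tensAppend v' (qubit true) - tensAppend w' (qubit false)) =
      hInner v v' - hInner w w' := by
  simp [hInner, sum_split, tensAppend_snoc, Finset.sum_add_distrib, sub_eq_add_neg]

theorem hInner_sub_sub {n : ℕ} (v w v' w' : H n) :
    hInner (tensAppend v (qubit true) - tensAppend w (qubit false))
      (tensAppend v' (qubit true) - tensAppend w' (qubit false)) =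
      hInner v v' + hInner w w' := by
  simp [hInner, sum_split, tensAppend_snoc, Finset.sum_add_distrib]

theorem hInner_one (v w : H 1) :
    hInner v w = (starRingEnd ℂ) (v fun _ => true) * w (fun _ => true) +
      (starRingEnd ℂ) (v fun _ => false) * w (fun _ => false) := by
  unfold hInner
  rw [← (Equiv.funUnique (Fin 1) Bool).symm.sum_comp, Fintype.sum_bool]
  rfl

/-- For every `n ≥ 1` (here `n = k + 1`), the two conditional photon states are
orthogonal and of equal (squared) norm: `⟨S_+^(n), S_-^(n)⟩ = 0` and
`‖S_+^(n)‖² = ‖S_-^(n)‖² = 2^n`. -/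
theorem protocol_states_orthogonal_equal_norm :
    ∀ k : ℕ,
      hInner (S k true) (S k false) = 0 ∧
      hInner (S k true) (S k true) = 2 ^ (k + 1) ∧
      hInner (S k false) (S k false) = 2 ^ (k + 1) := by
  intro k
  induction k with
  | zero =>
    simp only [hInner_one, S, Pi.add_apply, Pi.sub_apply, qubit_const]
    norm_num
  | succ k ih =>
    obtain ⟨_, h1, h2⟩ := ih
    simp only [S, hInner_comb, hInner_comb_sub, hInner_sub_sub, h1, h2]
    refine ⟨by ring, by ring, by ring⟩
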